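/- arXiv:math/0611147 — 3 statements merged into one kernel-verified Lean document; each statement's English description precedes it below -/
import Mathlib

section
/- Let X be a topological space and A ⊆ X a closed subset which is a strong deformation retract of X, witnessed by a continuous map F : X × [0,1] → X with F(x,0) = x for all x ∈ X, F(x,1) ∈ A for all x ∈ X, and F(a,t) = a for all a ∈ A and t ∈ [0,1]. Let π : Ỹ → Y be a covering map, let ρ : X → Y be continuous, and let σ : A → Ỹ be a continuous map with π ∘ σ = ρ on A. Then there exists a unique continuous map σ̃ : X → Ỹ such that π ∘ σ̃ = ρ on X and σ̃ = σ on A. -/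
/-- Unique lifting of a continuous map along a covering map, given a lift
on a closed strong deformation retract. -/
theorem stmt_1 {X Y Ytil : Type*} [TopologicalSpace X] [TopologicalSpace Y]
    [TopologicalSpace Ytil]
    (A : Set X) (hA : IsClosed A)
    (F : X × unitInterval → X) (hF_cont : Continuous F)
    (hF0 : ∀ x : X, F (x, 0) = x)
    (hF1 : ∀ x : X, F (x, 1) ∈ A)
    (hFA : ∀ a ∈ A, ∀ t : unitInterval, F (a, t) = a)
    (π : Ytil → Y) (hπ : IsCoveringMap π)
    (ρ : X → Y) (hρ : Continuous ρ)
    (σ : A → Ytil) (hσ_cont : Continuous σ)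
    (hσ_lift : ∀ a : A, π (σ a) = ρ a) :
    ∃! σt : X → Ytil,
      Continuous σt ∧ (∀ x : X, π (σt x) = ρ x) ∧ (∀ a : A, σt a = σ a) := by
  let H : C(unitInterval × X, Y) :=
    ⟨fun p ↦ ρ (F (p.2, unitInterval.symm p.1)), by fun_prop⟩
  let f : C(X, Ytil) := ⟨fun x ↦ σ ⟨F (x, 1), hF1 x⟩, by fun_prop⟩
  have H_zero : ∀ x, H (0, x) = π (f x) := fun x ↦ by simp [H, f, hσ_lift]
  let L := hπ.liftHomotopy H f H_zero
  have L_lifts (t x) : π (L (t, x)) = H (t, x) :=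
    congrFun (hπ.liftHomotopy_lifts H f H_zero) (t, x)
  have L_zero (x) : L (0, x) = f x := hπ.liftHomotopy_zero H f H_zero x
  refine ⟨fun x ↦ L (1, x), ⟨by fun_prop, fun x ↦ ?_, fun a ↦ ?_⟩, ?_⟩
  · simp [L_lifts, H, hF0]
  · have hconst : (fun t ↦ L (t, (a : X))) = fun _ ↦ σ a := by
      refine hπ.eq_of_comp_eq (by fun_prop) (by fun_prop) ?_ 0 ?_
      · ext t
        simp [L_lifts, H, hFA a a.2, hσ_lift]
      · simp [L_zero, f, hFA a a.2]
    exact congrFun hconst 1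
  · rintro τ ⟨hτ, τ_lifts, τ_eq⟩
    have hL : (fun p : unitInterval × X ↦ τ (F (p.2, unitInterval.symm p.1))) = L := by
      refine (hπ.eq_liftHomotopy_iff H_zero _).2 ⟨fun x ↦ by fun_prop, ?_, fun x ↦ ?_⟩
      · ext p
        simp [H, τ_lifts]
      · simpa [f] using τ_eq ⟨F (x, 1), hF1 x⟩
    ext x
    simpa [hF0] using congrFun hL (1, x)
end

section
/- Let P be a polynomial over ℂ, let m ≥ 1, and let q₀' ∈ ℂ satisfy P^m(q₀') = q₀'. Write q_k' = P^k(q₀') and let H₀ : ℂ² → ℂ² be H₀(x,y) = (y, P(y)). Then the (Fréchet) derivative of the m-th iterate H₀^m at the point q₀ = (q₀', q₁') is the ℂ-linear map (u,v) ↦ (c·v, M·v), where c = ∏_{k=1}^{m−1} P'(q_k') and M = ∏_{k=1}^{m} P'(q_k') (note M equals the multiplier of the periodic orbit of q₀' under P). In particular, in the standard basis this derivative has matrix [[0, c],[0, M]], its eigenvalues are 0 and M, and if M ≠ 1 then D(H₀^m)(q₀) − Id is invertible. -/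
theorem Polynomial.hasDerivAt_iterate_eval {𝕜 : Type*} [NontriviallyNormedField 𝕜]
    (P : Polynomial 𝕜) (n : ℕ) (y : 𝕜) :
    HasDerivAt (fun z => P.eval z)^[n]
      (∏ k ∈ Finset.range n, P.derivative.eval ((fun z => P.eval z)^[k] y)) y := by
  induction n with
  | zero => simpa using hasDerivAt_id y
  | succ n ih =>
    rw [Finset.prod_range_succ, mul_comm, Function.iterate_succ']
    exact (P.hasDerivAt _).comp y ih

theorem iterate_succ_degenerate_henon {α : Type*} (f : α → α) (H : α × α → α × α)
    (hH : ∀ p, H p = (p.2, f p.2)) (n : ℕ) (p : α × α) :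
    H^[n + 1] p = (f^[n] p.2, f^[n + 1] p.2) := by
  induction n with
  | zero => simp [hH]
  | succ n ih => rw [Function.iterate_succ_apply', ih, hH, ← Function.iterate_succ_apply' f]

theorem ContinuousLinearMap.isUnit_sub_id_of_apply_eq {𝕜 : Type*} [NontriviallyNormedField 𝕜]
    (A : 𝕜 × 𝕜 →L[𝕜] 𝕜 × 𝕜) {c M : 𝕜} (hA : ∀ u v, A (u, v) = (c * v, M * v)) (hM : M ≠ 1) :
    IsUnit (A - ContinuousLinearMap.id 𝕜 (𝕜 × 𝕜)) := by
  have hM' : M - 1 ≠ 0 := sub_ne_zero.mpr hM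
  let B : 𝕜 × 𝕜 →L[𝕜] 𝕜 × 𝕜 :=
    ((c / (M - 1)) • ContinuousLinearMap.snd 𝕜 𝕜 𝕜 - ContinuousLinearMap.fst 𝕜 𝕜 𝕜).prod
      ((M - 1)⁻¹ • ContinuousLinearMap.snd 𝕜 𝕜 𝕜)
  have hB : ∀ u v, B (u, v) = (c / (M - 1) * v - u, (M - 1)⁻¹ * v) := fun u v => by simp [B]
  refine ⟨⟨A - ContinuousLinearMap.id 𝕜 (𝕜 × 𝕜), B, ?_, ?_⟩, rfl⟩ <;>
  · refine ContinuousLinearMap.ext fun ⟨u, v⟩ => ?_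
    simp only [mul_apply_eq_comp, sub_apply,
      ContinuousLinearMap.id_apply, one_apply_eq_self, hA, hB, Prod.mk_sub_mk,
      Prod.mk.injEq]
    exact ⟨by field_simp; ring, by field_simp⟩


/-- The derivative of the `m`-th iterate of the degenerate Hénon map
`H₀(x,y) = (y, P(y))` at the periodic point `q₀ = (q₀', q₁')` is
`(u,v) ↦ (c·v, M·v)` with `c = ∏_{k=1}^{m-1} P'(q_k')` and `M = ∏_{k=1}^{m} P'(q_k')`;
`M` is the multiplier of the orbit, the eigenvalues are `0` and `M`, and if `M ≠ 1`
then `D(H₀^m)(q₀) - Id` is invertible. -/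
theorem stmt_9 (P : Polynomial ℂ) (m : ℕ) (hm : 1 ≤ m)
    (q₀' : ℂ) (hper : (fun z => P.eval z)^[m] q₀' = q₀')
    (q : ℕ → ℂ) (hq : ∀ k, q k = (fun z => P.eval z)^[k] q₀')
    (H₀ : ℂ × ℂ → ℂ × ℂ) (hH : ∀ p, H₀ p = (p.2, P.eval p.2))
    (c M : ℂ)
    (hc : c = ∏ k ∈ Finset.Ico 1 m, P.derivative.eval (q k))
    (hM : M = ∏ k ∈ Finset.Icc 1 m, P.derivative.eval (q k)) :
    (∀ u v : ℂ, fderiv ℂ (H₀^[m]) (q₀', q 1) (u, v) = (c * v, M * v)) ∧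
    (M = ∏ k ∈ Finset.range m, P.derivative.eval (q k)) ∧
    (∃ w : ℂ × ℂ, w ≠ 0 ∧ fderiv ℂ (H₀^[m]) (q₀', q 1) w = (0 : ℂ) • w) ∧
    (∃ w : ℂ × ℂ, w ≠ 0 ∧ fderiv ℂ (H₀^[m]) (q₀', q 1) w = M • w) ∧
    (M ≠ 1 →
      IsUnit (fderiv ℂ (H₀^[m]) (q₀', q 1) - ContinuousLinearMap.id ℂ (ℂ × ℂ))) := by
  obtain ⟨n, rfl⟩ : ∃ n, m = n + 1 := ⟨m - 1, by omega⟩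
  have hshift : ∀ k, (fun z => P.eval z)^[k] (q 1) = q (k + 1) := fun k => by
    rw [hq, hq, ← Function.iterate_add_apply]
  have hc' : c = ∏ k ∈ Finset.range n, P.derivative.eval (q (k + 1)) := by
    rw [hc, Finset.prod_Ico_eq_prod_range]
    simp [add_comm]
  have hM' : M = ∏ k ∈ Finset.range (n + 1), P.derivative.eval (q (k + 1)) := by
    rw [hM, ← Finset.Ico_add_one_right_eq_Icc, Finset.prod_Ico_eq_prod_range]
    simp [add_comm]
  have hderiv : ∀ k, HasFDerivAt (fun p : ℂ × ℂ => (fun z => P.eval z)^[k] p.2)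
      ((∏ j ∈ Finset.range k, P.derivative.eval (q (j + 1))) • ContinuousLinearMap.snd ℂ ℂ ℂ)
      (q₀', q 1) := fun k => by
    have h := P.hasDerivAt_iterate_eval k (q 1)
    simp only [hshift] at h
    exact h.comp_hasFDerivAt (q₀', q 1) hasFDerivAt_snd
  have hiter : H₀^[n + 1] =
      fun p => ((fun z => P.eval z)^[n] p.2, (fun z => P.eval z)^[n + 1] p.2) :=
    funext (iterate_succ_degenerate_henon _ H₀ hH n)
  have hD : ∀ u v : ℂ, fderiv ℂ (H₀^[n + 1]) (q₀', q 1) (u, v) = (c * v, M * v) := fun u v => by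
    rw [hiter, ((hderiv n).prodMk (hderiv (n + 1))).fderiv, ← hc', ← hM']
    simp
  refine ⟨hD, ?_, ⟨(1, 0), by simp, by rw [hD]; simp⟩, ?_,
    ContinuousLinearMap.isUnit_sub_id_of_apply_eq _ hD⟩
  · have hq0 : q (n + 1) = q 0 := by rw [hq, hper, hq, Function.iterate_zero_apply]
    rw [hM', Finset.prod_range_succ, Finset.prod_range_succ', hq0]
  · by_cases h0 : M = 0
    · exact ⟨(1, 0), by simp, by rw [hD]; simp [h0]⟩
    · exact ⟨(c, M), by simp [h0], by rw [hD]; simp [mul_comm]⟩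
end

section
/- Let H : ℂ² → ℂ² be H(x,y) = (y, y²) and define γ : ℂ → ℂ² by γ(z) = (exp(z/2), exp(z)). Then: (i) γ(0) = (1,1), which is a fixed point of H; (ii) H(γ(z)) = γ(2z) for all z ∈ ℂ; (iii) γ(z) = lim_{n→∞} Hⁿ(1 + z/2^{n+1}, 1 + z/2ⁿ), with the convergence locally uniform in z ∈ ℂ; and (iv) γ is not injective: γ(z + 4πi) = γ(z) for all z ∈ ℂ. -/
open Filter Topology

/-- Lipschitz-type bound for the `k`-th power on the ball of radius `M ≥ 1`. -/
lemma norm_pow_sub_pow_le_of_norm_le {a b : ℂ} {M : ℝ} (hM : 1 ≤ M) (ha : ‖a‖ ≤ M)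
    (hb : ‖b‖ ≤ M) (k : ℕ) : ‖a ^ k - b ^ k‖ ≤ k * ‖a - b‖ * M ^ k := by
  induction k with
  | zero => simp
  | succ k ih =>
    have h0 : (0 : ℝ) ≤ M := by linarith
    calc ‖a ^ (k + 1) - b ^ (k + 1)‖ = ‖a * (a ^ k - b ^ k) + (a - b) * b ^ k‖ := by
          congr 1; ring
      _ ≤ ‖a‖ * ‖a ^ k - b ^ k‖ + ‖a - b‖ * ‖b‖ ^ k := by
          refine (norm_add_le _ _).trans ?_
          simp only [norm_mul, norm_pow, le_refl]
      _ ≤ M * (k * ‖a - b‖ * M ^ k) + ‖a - b‖ * M ^ (k + 1) := by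
          have hbk : ‖b‖ ^ k ≤ M ^ (k + 1) :=
            (pow_le_pow_left₀ (norm_nonneg b) hb k).trans (pow_le_pow_right₀ hM k.le_succ)
          gcongr
      _ = (k + 1 : ℕ) * ‖a - b‖ * M ^ (k + 1) := by push_cast; ring

lemma norm_exp_sub_one_add_div_pow_le {z : ℂ} {k : ℕ} (hk : 0 < k) (hz : ‖z‖ ≤ k) :
    ‖Complex.exp z - (1 + z / k) ^ k‖ ≤ ‖z‖ ^ 2 * Real.exp ‖z‖ / k := by
  have hk' : (0 : ℝ) < k := by exact_mod_cast hk
  have hkc : (k : ℂ) ≠ 0 := by exact_mod_cast hk.ne'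
  have hn : ‖z / k‖ = ‖z‖ / k := by simp
  have hu : ‖z / k‖ ≤ 1 := by rw [hn]; exact (div_le_one hk').2 hz
  have hb : ‖1 + z / k‖ ≤ Real.exp ‖z / k‖ := by
    refine (norm_add_le _ _).trans ?_
    rw [norm_one, add_comm]
    exact Real.add_one_le_exp _
  have key := norm_pow_sub_pow_le_of_norm_le (Real.one_le_exp (norm_nonneg (z / k)))
    (Complex.norm_exp_le_exp_norm (z / k)) hb k
  rw [← Complex.exp_nat_mul, ← Real.exp_nat_mul, mul_div_cancel₀ _ hkc, hn,
    mul_div_cancel₀ _ hk'.ne'] at key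
  have h2 : ‖Complex.exp (z / k) - (1 + z / k)‖ ≤ (‖z‖ / k) ^ 2 := by
    rw [← hn, ← sub_sub]
    exact Complex.norm_exp_sub_one_sub_id_le hu
  calc _ ≤ _ := key
    _ ≤ k * (‖z‖ / k) ^ 2 * Real.exp ‖z‖ := by gcongr
    _ = _ := by field_simp

lemma tendstoLocallyUniformly_one_add_div_pow_exp :
    TendstoLocallyUniformly (fun (k : ℕ) (z : ℂ) => (1 + z / k) ^ k) Complex.exp atTop := by
  rw [Metric.tendstoLocallyUniformly_iff]
  intro ε hε x
  refine ⟨Metric.ball x 1, Metric.ball_mem_nhds x one_pos, ?_⟩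
  set R : ℝ := ‖x‖ + 1 with hR
  have hlim : Tendsto (fun k : ℕ => R ^ 2 * Real.exp R / k) atTop (𝓝 0) :=
    tendsto_const_div_atTop_nhds_zero_nat _
  filter_upwards [hlim.eventually_lt_const hε, eventually_gt_atTop 0,
    tendsto_natCast_atTop_atTop.eventually_ge_atTop R] with k hk hk0 hkR z hz
  have hzR : ‖z‖ ≤ R := by
    have h := norm_add_le x (z - x)
    rw [add_sub_cancel] at h
    rw [Metric.mem_ball, dist_eq_norm] at hz
    linarith
  rw [dist_eq_norm]
  refine ((norm_exp_sub_one_add_div_pow_le hk0 (hzR.trans hkR)).trans ?_).trans_lt hk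
  gcongr

lemma tendstoLocallyUniformly_one_add_div_two_pow_exp :
    TendstoLocallyUniformly (fun (n : ℕ) (z : ℂ) => (1 + z / 2 ^ n) ^ 2 ^ n) Complex.exp
      atTop := by
  intro u hu x
  obtain ⟨t, ht, h⟩ := tendstoLocallyUniformly_one_add_div_pow_exp u hu x
  refine ⟨t, ht, ?_⟩
  simpa using (tendsto_pow_atTop_atTop_of_one_lt (one_lt_two : 1 < (2 : ℕ))).eventually h

lemma iterate_succ_of_eq_snd_sq {H : ℂ × ℂ → ℂ × ℂ} (hH : ∀ p : ℂ × ℂ, H p = (p.2, p.2 ^ 2))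
    (n : ℕ) (p : ℂ × ℂ) : H^[n + 1] p = (p.2 ^ 2 ^ n, p.2 ^ 2 ^ (n + 1)) := by
  induction n with
  | zero => simp [hH]
  | succ n ih =>
    rw [Function.iterate_succ_apply', ih, hH, ← pow_mul, ← pow_succ]

/-- For `H(x,y) = (y, y²)` the linearizing coordinate
`γ(z) = (exp(z/2), exp z)` at the fixed point `(1,1)` satisfies `γ(0) = (1,1)`,
`H(γ(z)) = γ(2z)`, arises as the locally uniform limit of
`Hⁿ(1 + z/2^{n+1}, 1 + z/2ⁿ)`, and is non-injective with period `4πi`. -/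
theorem stmt_15 (H : ℂ × ℂ → ℂ × ℂ) (hH : ∀ p : ℂ × ℂ, H p = (p.2, p.2 ^ 2))
    (γ : ℂ → ℂ × ℂ) (hγ : ∀ z : ℂ, γ z = (Complex.exp (z / 2), Complex.exp z)) :
    γ 0 = (1, 1) ∧ H (1, 1) = (1, 1) ∧
    (∀ z : ℂ, H (γ z) = γ (2 * z)) ∧
    TendstoLocallyUniformly
      (fun (n : ℕ) (z : ℂ) => H^[n] (1 + z / 2 ^ (n + 1), 1 + z / 2 ^ n))
      γ Filter.atTop ∧
    (¬ Function.Injective γ) ∧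
    (∀ z : ℂ, γ (z + 4 * Real.pi * Complex.I) = γ z) := by
  have hperiod : ∀ z : ℂ, γ (z + 4 * Real.pi * Complex.I) = γ z := by
    intro z
    rw [hγ, hγ, Prod.mk.injEq]
    refine ⟨Complex.exp_eq_exp_iff_exists_int.2 ⟨1, ?_⟩,
      Complex.exp_eq_exp_iff_exists_int.2 ⟨2, ?_⟩⟩ <;> push_cast <;> ring
  refine ⟨by simp [hγ], by simp [hH], fun z => ?_, ?_, fun hinj => ?_, hperiod⟩
  · rw [hH, hγ, hγ, mul_div_cancel_left₀ z two_ne_zero, ← Complex.exp_nat_mul]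
    norm_num
  · have hE := tendstoLocallyUniformly_one_add_div_two_pow_exp
    rw [Metric.tendstoLocallyUniformly_iff] at hE ⊢
    intro ε hε x
    obtain ⟨t, ht, h⟩ := hE ε hε x
    obtain ⟨s, hs, h'⟩ := hE ε hε (x / 2)
    have hs' : (fun z : ℂ => z / 2) ⁻¹' s ∈ 𝓝 x :=
      (continuous_id.div_const (2 : ℂ)).continuousAt.preimage_mem_nhds hs
    refine ⟨t ∩ (fun z : ℂ => z / 2) ⁻¹' s, inter_mem ht hs', ?_⟩
    filter_upwards [h, (tendsto_sub_atTop_nat 1).eventually h', eventually_ge_atTop 1]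
      with n h1 h2 hn z hz
    obtain ⟨m, rfl⟩ := Nat.exists_eq_add_of_le' hn
    rw [iterate_succ_of_eq_snd_sq hH, hγ, Prod.dist_eq, max_lt_iff]
    refine ⟨?_, h1 z hz.1⟩
    have h3 := h2 (z / 2) hz.2
    rwa [Nat.add_sub_cancel, div_div, ← pow_succ'] at h3
  · have h := hinj (hperiod 0)
    simp [Real.pi_ne_zero] at h
end
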